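/- Let Y be a real-valued random variable with the normal distribution N(μ, σ²), σ > 0, with density f(x) = (1/(σ√(2π)))·exp(−(x−μ)²/(2σ²)). Then for every real y, Pr( f(Y) ≤ f(y) ) = 2·(1 − Φ(|y − μ|/σ)), where Φ is the standard normal cumulative distribution function. -/

import Mathlib

open MeasureTheory ProbabilityTheory Real

/-- For `Y ~ N(μ, σ²)` with density `f`, the surprisal tail probability of an
observation `y` is `Pr(f(Y) ≤ f(y)) = 2(1 − Φ(|y − μ|/σ))`, where `Φ` is the standard
normal CDF. -/
theorem normal_surprisal_prob
    {Ω : Type*} [MeasurableSpace Ω] (P : Measure Ω) [IsProbabilityMeasure P]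
    (Y : Ω → ℝ) (hmeas : Measurable Y)
    (μ σ : ℝ) (hσ : 0 < σ)
    (f : ℝ → ℝ)
    (hf : ∀ x : ℝ, f x = (σ * Real.sqrt (2 * Real.pi))⁻¹ *
      Real.exp (-(x - μ) ^ 2 / (2 * σ ^ 2)))
    (hY : Measure.map Y P = gaussianReal μ ⟨σ ^ 2, sq_nonneg σ⟩)
    (y : ℝ) :
    (P {ω | f (Y ω) ≤ f y}).toReal =
      2 * (1 - ((gaussianReal 0 1) (Set.Iic (|y - μ| / σ))).toReal) := by
  obtain ⟨v, hv, hY⟩ : ∃ v : NNReal, (v : ℝ) = σ ^ 2 ∧ Measure.map Y P = gaussianReal μ v :=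
    ⟨_, rfl, hY⟩
  have hZ : Measure.map (fun ω => (Y ω - μ) / σ) P = gaussianReal 0 1 := by
    have h1 : (fun ω => (Y ω - μ) / σ) = (fun x => x / σ) ∘ (fun x => x - μ) ∘ Y := rfl
    rw [h1, ← Measure.map_map (by fun_prop) (by fun_prop),
      ← Measure.map_map (by fun_prop) hmeas, hY, gaussianReal_map_sub_const,
      gaussianReal_map_div_const]
    congr 1
    · simp
    · ext
      have : σ ^ 2 ≠ 0 := by positivity
      simp only [NNReal.coe_div, NNReal.coe_mk, NNReal.coe_one, hv]
      exact div_self this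
  have hset : {ω | f (Y ω) ≤ f y} = (fun ω => (Y ω - μ) / σ) ⁻¹'
      (Set.Iic (-(|y - μ| / σ)) ∪ Set.Ici (|y - μ| / σ)) := by
    ext ω
    have hc : 0 < (σ * Real.sqrt (2 * Real.pi))⁻¹ := by positivity
    simp only [Set.mem_ofPred_eq, Set.mem_preimage, Set.mem_union, Set.mem_Iic, Set.mem_Ici, hf]
    rw [mul_le_mul_iff_right₀ hc, Real.exp_le_exp, div_le_div_iff_of_pos_right (by positivity),
      neg_le_neg_iff, sq_le_sq, ← neg_div, div_le_div_iff_of_pos_right hσ,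
      div_le_div_iff_of_pos_right hσ, le_abs, le_neg, or_comm]
  have ht : 0 ≤ |y - μ| / σ := by positivity
  generalize |y - μ| / σ = t at *
  have hna : NullSingletonClass (gaussianReal 0 1) := nullSingletonClass_gaussianReal one_ne_zero
  have hdisj : AEDisjoint (gaussianReal 0 1) (Set.Iic (-t)) (Set.Ici t) := by
    refine measure_mono_null (t := {t}) ?_ (measure_singleton t)
    rintro x ⟨h1, h2⟩
    simp only [Set.mem_Iic, Set.mem_Ici] at h1 h2
    simp only [Set.mem_singleton_iff]
    linarith
  have hneg : gaussianReal 0 1 (Set.Iic (-t)) = gaussianReal 0 1 (Set.Ici t) := by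
    have h : (gaussianReal 0 1).map (fun x ↦ -x) = gaussianReal 0 1 := by
      rw [gaussianReal_map_neg, neg_zero]
    conv_lhs => rw [← h]
    rw [Measure.map_apply measurable_neg measurableSet_Iic]
    congr 1
    ext x
    simp
  have htail : (gaussianReal 0 1 (Set.Ici t)).toReal
      = 1 - (gaussianReal 0 1 (Set.Iic t)).toReal := by
    rw [← measure_congr (Ioi_ae_eq_Ici (μ := gaussianReal 0 1)), ← Set.compl_Iic]
    exact probReal_compl_eq_one_sub measurableSet_Iic
  rw [hset, ← Measure.map_apply (by fun_prop) (measurableSet_Iic.union measurableSet_Ici), hZ,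
    measure_union₀ measurableSet_Ici.nullMeasurableSet hdisj, hneg,
    ENNReal.toReal_add (measure_ne_top _ _) (measure_ne_top _ _), htail]
  ring
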